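/- Let ({X_k*}, {ρ_k*}) be an optimal solution of the SDR problem. Then there exist vectors v_1*,…,v_K* ∈ ℂ^{N_t} with X_k* = v_k* (v_k*)^H for all k, the pair ({v_k*}, {ρ_k*}) is feasible for the JBPS problem, its transmit power satisfies Σ_k ‖v_k*‖² = Σ_k Tr(X_k*), and ({v_k*}, {ρ_k*}) is optimal for the JBPS problem: Σ_k ‖v_k*‖² ≤ Σ_k ‖v_k‖² for every JBPS-feasible ({v_k}, {ρ_k}). -/

import Mathlib

noncomputable section

open Finset Matrix
open scoped ComplexOrder

/-- The (real) quadratic form `h^H X h` (its real part; it is real for Hermitian `X`). -/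
def quadForm {Nt : ℕ} (h : Fin Nt → ℂ) (X : Matrix (Fin Nt) (Fin Nt) ℂ) : ℝ :=
  (star h ⬝ᵥ X *ᵥ h).re

/-- Feasibility of the semidefinite relaxation (SDR) of the JBPS problem. -/
def SDRFeasible {K Nt : ℕ} (h : Fin K → (Fin Nt → ℂ)) (σ2 δ2 ζ γ e : Fin K → ℝ)
    (X : Fin K → Matrix (Fin Nt) (Fin Nt) ℂ) (ρ : Fin K → ℝ) : Prop :=
  (∀ k, (X k).PosSemidef) ∧ (∀ k, 0 < ρ k ∧ ρ k < 1) ∧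
  (∀ k, σ2 k + δ2 k / ρ k ≤
      (1 / γ k) * quadForm (h k) (X k) - ∑ j ∈ univ.erase k, quadForm (h k) (X j)) ∧
  (∀ k, e k / (ζ k * (1 - ρ k)) - σ2 k ≤ ∑ j, quadForm (h k) (X j))

/-- Feasibility of the joint beamforming and power splitting (JBPS) problem. -/
def JBPSFeasible {K Nt : ℕ} (h : Fin K → (Fin Nt → ℂ)) (σ2 δ2 ζ γ e : Fin K → ℝ)
    (v : Fin K → (Fin Nt → ℂ)) (ρ : Fin K → ℝ) : Prop :=
  (∀ k, 0 < ρ k ∧ ρ k < 1) ∧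
  (∀ k, γ k ≤ ρ k * ‖star (h k) ⬝ᵥ v k‖ ^ 2 /
      (ρ k * ∑ j ∈ univ.erase k, ‖star (h k) ⬝ᵥ v j‖ ^ 2 + ρ k * σ2 k + δ2 k)) ∧
  (∀ k, e k ≤ ζ k * (1 - ρ k) * ((∑ j, ‖star (h k) ⬝ᵥ v j‖ ^ 2) + σ2 k))

section QuadForm

variable {Nt : ℕ} (h : Fin Nt → ℂ)

lemma quadForm_zero : quadForm h 0 = 0 := by simp [quadForm]

lemma quadForm_add (X Y : Matrix (Fin Nt) (Fin Nt) ℂ) :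
    quadForm h (X + Y) = quadForm h X + quadForm h Y := by
  simp [quadForm, add_mulVec, dotProduct_add]

lemma quadForm_sub (X Y : Matrix (Fin Nt) (Fin Nt) ℂ) :
    quadForm h (X - Y) = quadForm h X - quadForm h Y := by
  simp [quadForm, sub_mulVec, dotProduct_sub]

lemma quadForm_smul (t : ℝ) (X : Matrix (Fin Nt) (Fin Nt) ℂ) :
    quadForm h (t • X) = t * quadForm h X := by
  simp [quadForm, smul_mulVec, dotProduct_smul]

lemma quadForm_nonneg {X : Matrix (Fin Nt) (Fin Nt) ℂ} (hX : X.PosSemidef) :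
    0 ≤ quadForm h X :=
  (Complex.le_def.1 (hX.dotProduct_mulVec_nonneg h)).1

lemma ofReal_quadForm {X : Matrix (Fin Nt) (Fin Nt) ℂ} (hX : X.PosSemidef) :
    (quadForm h X : ℂ) = star h ⬝ᵥ X *ᵥ h :=
  Complex.ext rfl (Complex.le_def.1 (hX.dotProduct_mulVec_nonneg h)).2

lemma quadForm_vecMulVec (v : Fin Nt → ℂ) :
    quadForm h (vecMulVec v (star v)) = ‖star h ⬝ᵥ v‖ ^ 2 := by
  have hs : star v ⬝ᵥ h = star (star h ⬝ᵥ v) := star_dotProduct v h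
  rw [quadForm, vecMulVec_mulVec, dotProduct_smul, hs, op_smul_eq_smul, smul_eq_mul, mul_comm]
  simp only [Complex.star_def, Complex.mul_conj, Complex.ofReal_re, Complex.normSq_eq_norm_sq]

lemma trace_vecMulVec_star_re (v : Fin Nt → ℂ) :
    (vecMulVec v (star v)).trace.re = ∑ i, ‖v i‖ ^ 2 := by
  simp only [Matrix.trace, diag_apply, vecMulVec_apply, Pi.star_apply, Complex.star_def,
    Complex.mul_conj, Complex.re_sum, Complex.ofReal_re, Complex.normSq_eq_norm_sq]

end QuadForm

section RankOne

variable {Nt : ℕ}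

/-- The Schur-complement-type residual of a positive semidefinite matrix along `h`. -/
lemma posSemidef_sub_vecMulVec {X : Matrix (Fin Nt) (Fin Nt) ℂ} (hX : X.PosSemidef)
    (h : Fin Nt → ℂ) (hq : 0 < quadForm h X) :
    (X - (quadForm h X)⁻¹ • vecMulVec (X *ᵥ h) (star (X *ᵥ h))).PosSemidef := by
  set q := quadForm h X with hqdef
  have hqC : (q : ℂ) = star h ⬝ᵥ X *ᵥ h := ofReal_quadForm h hX
  have hH : star (X *ᵥ h) = star h ᵥ* X := by rw [star_mulVec, hX.isHermitian.eq]
  have hne : (q : ℂ) ≠ 0 := by exact_mod_cast hq.ne'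
  convert hX.conjTranspose_mul_mul_same
    (1 - (q⁻¹ : ℂ) • vecMulVec h (star (X *ᵥ h))) using 1
  have hct : ((q⁻¹ : ℂ) • vecMulVec h (star (X *ᵥ h)))ᴴ
      = (q⁻¹ : ℂ) • vecMulVec (X *ᵥ h) (star h) := by
    rw [conjTranspose_smul, conjTranspose_vecMulVec, star_star]
    simp
  rw [conjTranspose_sub, hct, conjTranspose_one]
  have h1 : vecMulVec (X *ᵥ h) (star h) * X = vecMulVec (X *ᵥ h) (star (X *ᵥ h)) := by
    rw [vecMulVec_mul, hH]
  have h2 : X * vecMulVec h (star (X *ᵥ h)) = vecMulVec (X *ᵥ h) (star (X *ᵥ h)) := by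
    rw [mul_vecMulVec]
  have h3 : vecMulVec (X *ᵥ h) (star (X *ᵥ h)) * vecMulVec h (star (X *ᵥ h))
      = (q : ℂ) • vecMulVec (X *ᵥ h) (star (X *ᵥ h)) := by
    rw [vecMulVec_mul_vecMulVec, hH, ← dotProduct_mulVec, ← hqC, ← vecMulVec_smul]
  have h4 : (q⁻¹ : ℝ) • vecMulVec (X *ᵥ h) (star (X *ᵥ h))
      = (q⁻¹ : ℂ) • vecMulVec (X *ᵥ h) (star (X *ᵥ h)) := by
    ext i j; simp
  rw [h4, sub_mul, one_mul, smul_mul_assoc, h1, mul_sub, mul_one, mul_smul_comm, sub_mul, h2,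
    smul_mul_assoc, h3, smul_smul, inv_mul_cancel₀ hne, one_smul, sub_self, smul_zero, sub_zero]

lemma trace_re_pos {X : Matrix (Fin Nt) (Fin Nt) ℂ} (hX : X.PosSemidef) (h0 : X ≠ 0) :
    0 < X.trace.re := by
  have h1 := Complex.le_def.1 hX.trace_nonneg
  refine lt_of_le_of_ne h1.1 fun h2 => h0 (hX.trace_eq_zero_iff.1 ?_)
  exact Complex.ext h2.symm h1.2.symm

end RankOne

section Relaxation

variable {K Nt : ℕ} {h : Fin K → (Fin Nt → ℂ)} {σ2 δ2 ζ γ e : Fin K → ℝ}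

/-- The left-hand side of the SINR constraint of user `k` in the relaxation. -/
def sinrGap (h : Fin K → (Fin Nt → ℂ)) (γ : Fin K → ℝ)
    (X : Fin K → Matrix (Fin Nt) (Fin Nt) ℂ) (k : Fin K) : ℝ :=
  (1 / γ k) * quadForm (h k) (X k) - ∑ j ∈ univ.erase k, quadForm (h k) (X j)

lemma sinrGap_eq (X : Fin K → Matrix (Fin Nt) (Fin Nt) ℂ) (k : Fin K) :
    sinrGap h γ X k = (1 / γ k + 1) * quadForm (h k) (X k) - ∑ j, quadForm (h k) (X j) := by
  rw [sinrGap, Finset.sum_erase_eq_sub (mem_univ k)]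
  ring

/-- Transfer the covariance `D` from user `j` to user `k`. -/
def transfer (X : Fin K → Matrix (Fin Nt) (Fin Nt) ℂ) (j k : Fin K)
    (D : Matrix (Fin Nt) (Fin Nt) ℂ) : Fin K → Matrix (Fin Nt) (Fin Nt) ℂ :=
  fun i => X i + (if i = k then D else 0) - (if i = j then D else 0)

lemma sum_quadForm_transfer (X : Fin K → Matrix (Fin Nt) (Fin Nt) ℂ) (j k : Fin K)
    (D : Matrix (Fin Nt) (Fin Nt) ℂ) (u : Fin Nt → ℂ) :
    ∑ i, quadForm u (transfer X j k D i) = ∑ i, quadForm u (X i) := by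
  simp [transfer, quadForm_add, quadForm_sub, apply_ite (quadForm u), quadForm_zero,
    Finset.sum_add_distrib]

lemma sum_trace_transfer (X : Fin K → Matrix (Fin Nt) (Fin Nt) ℂ) (j k : Fin K)
    (D : Matrix (Fin Nt) (Fin Nt) ℂ) :
    ∑ i, (transfer X j k D i).trace = ∑ i, (X i).trace := by
  simp [transfer, trace_add, trace_sub, apply_ite Matrix.trace, Finset.sum_add_distrib]

lemma sinrGap_transfer (X : Fin K → Matrix (Fin Nt) (Fin Nt) ℂ) (j k : Fin K)
    (D : Matrix (Fin Nt) (Fin Nt) ℂ) (i : Fin K) :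
    sinrGap h γ (transfer X j k D) i = sinrGap h γ X i + (1 / γ i + 1) *
      ((if i = k then quadForm (h i) D else 0) - (if i = j then quadForm (h i) D else 0)) := by
  rw [sinrGap_eq, sinrGap_eq, sum_quadForm_transfer]
  simp only [transfer, quadForm_add, quadForm_sub, apply_ite (quadForm (h i)), quadForm_zero]
  ring

lemma SDRFeasible.transfer (hγ : ∀ k, 0 < γ k) {X : Fin K → Matrix (Fin Nt) (Fin Nt) ℂ}
    {ρ : Fin K → ℝ} (hf : SDRFeasible h σ2 δ2 ζ γ e X ρ) {j k : Fin K} (hjk : k ≠ j)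
    {D : Matrix (Fin Nt) (Fin Nt) ℂ} (hD : D.PosSemidef) (hXD : (X j - D).PosSemidef)
    (hj : σ2 j + δ2 j / ρ j ≤ sinrGap h γ X j - (1 / γ j + 1) * quadForm (h j) D) :
    SDRFeasible h σ2 δ2 ζ γ e (transfer X j k D) ρ := by
  obtain ⟨hpsd, hρ, hsinr, hen⟩ := hf
  refine ⟨fun i => ?_, hρ, fun i => ?_, fun i => ?_⟩
  · by_cases hij : i = j
    · subst hij
      simpa [_root_.transfer, hjk.symm] using hXD
    · by_cases hik : i = k
      · subst hik
        simpa [_root_.transfer, hjk] using (hpsd i).add hD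
      · simpa [_root_.transfer, hij, hik] using hpsd i
  · change _ ≤ sinrGap h γ _ i
    rw [sinrGap_transfer]
    by_cases hij : i = j
    · subst hij
      simp only [hjk.symm, if_true, if_false]
      linarith
    · have h1 : σ2 i + δ2 i / ρ i ≤ sinrGap h γ X i := hsinr i
      have h2 : 0 ≤ (1 / γ i + 1) * (if i = k then quadForm (h i) D else 0) := by
        have := hγ i
        have := quadForm_nonneg (h i) hD
        split_ifs <;> positivity
      simp only [hij, if_false, sub_zero]
      linarith
  · rw [sum_quadForm_transfer]
    exact hen i

lemma SDRFeasible.quadForm_self_pos (hσ : ∀ k, 0 < σ2 k) (hδ : ∀ k, 0 < δ2 k)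
    (hγ : ∀ k, 0 < γ k) {X : Fin K → Matrix (Fin Nt) (Fin Nt) ℂ}
    {ρ : Fin K → ℝ} (hf : SDRFeasible h σ2 δ2 ζ γ e X ρ) (k : Fin K) :
    0 < quadForm (h k) (X k) := by
  obtain ⟨hpsd, hρ, hsinr, -⟩ := hf
  have h1 := hsinr k
  have h2 : 0 ≤ ∑ j ∈ univ.erase k, quadForm (h k) (X j) :=
    Finset.sum_nonneg fun j _ => quadForm_nonneg _ (hpsd j)
  have h3 := div_pos (hδ k) (hρ k).1
  have h4 : 0 < 1 / γ k * quadForm (h k) (X k) := by linarith [hσ k]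
  exact pos_of_mul_pos_right h4 (one_div_pos.2 (hγ k)).le

/-- Strict SINR slack can be shared with the energy constraint by lowering the splitting ratio. -/
lemma exists_lower_ratio {s d r z g L E : ℝ} (hd : 0 < d) (hr : 0 < r ∧ r < 1) (hz : 0 < z)
    (hg : 0 < g) (hL : s + d / r < L) (hE : g / (z * (1 - r)) - s ≤ E) :
    ∃ r', (0 < r' ∧ r' < 1) ∧ s + d / r' < L ∧ g / (z * (1 - r')) - s < E := by
  have hdr : 0 < d / r := div_pos hd hr.1
  have hLs : 0 < L - s := by linarith
  have h1 : d / (L - s) < r := by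
    rw [div_lt_iff₀ hLs, mul_comm, ← div_lt_iff₀ hr.1]
    linarith
  obtain ⟨r', h2, h3⟩ := exists_between h1
  have hr' : 0 < r' := (div_pos hd hLs).trans h2
  refine ⟨r', ⟨hr', h3.trans hr.2⟩, ?_, ?_⟩
  · rw [div_lt_iff₀ hLs, mul_comm, ← div_lt_iff₀ hr'] at h2
    linarith
  · have h4 : g / (z * (1 - r')) < g / (z * (1 - r)) :=
      div_lt_div_of_pos_left hg (mul_pos hz (by linarith [hr.2]))
        (mul_lt_mul_of_pos_left (by linarith) hz)
    linarith

/-- If the users of `S` have SINR slack and cause no signal at the other users, then the power can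
be strictly decreased. -/
lemma SDRFeasible.exists_trace_lt_of_decoupled (hσ : ∀ k, 0 < σ2 k) (hδ : ∀ k, 0 < δ2 k)
    (hζ : ∀ k, 0 < ζ k) (hγ : ∀ k, 0 < γ k) (he : ∀ k, 0 < e k)
    {X : Fin K → Matrix (Fin Nt) (Fin Nt) ℂ} {ρ : Fin K → ℝ}
    (hf : SDRFeasible h σ2 δ2 ζ γ e X ρ) {S : Finset (Fin K)}
    (hslack : ∀ i ∈ S, σ2 i + δ2 i / ρ i < sinrGap h γ X i) {j : Fin K} (hj : j ∈ S)
    (hdec : ∀ k ∉ S, quadForm (h k) (X j) = 0) :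
    ∃ X' ρ', SDRFeasible h σ2 δ2 ζ γ e X' ρ' ∧
      (∑ k, (X' k).trace).re < (∑ k, (X k).trace).re := by
  have hjpos := hf.quadForm_self_pos hσ hδ hγ j
  obtain ⟨hpsd, hρ, hsinr, hen⟩ := hf
  have hex : ∀ i, ∃ r, (0 < r ∧ r < 1) ∧ σ2 i + δ2 i / r ≤ sinrGap h γ X i ∧
      e i / (ζ i * (1 - r)) - σ2 i ≤ ∑ m, quadForm (h i) (X m) ∧
      (i ∈ S → σ2 i + δ2 i / r < sinrGap h γ X i ∧
        e i / (ζ i * (1 - r)) - σ2 i < ∑ m, quadForm (h i) (X m)) := by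
    intro i
    by_cases hi : i ∈ S
    · obtain ⟨r, h1, h2, h3⟩ :=
        exists_lower_ratio (hδ i) (hρ i) (hζ i) (he i) (hslack i hi) (hen i)
      exact ⟨r, h1, h2.le, h3.le, fun _ => ⟨h2, h3⟩⟩
    · exact ⟨ρ i, hρ i, hsinr i, hen i, fun hi' => absurd hi' hi⟩
  choose ρ' hρ' hsinr' hen' hstrict using hex
  let Y : ℝ → Fin K → Matrix (Fin Nt) (Fin Nt) ℂ :=
    fun t i => X i - if i = j then t • X j else 0
  have hsum : ∀ t i, ∑ m, quadForm (h i) (Y t m) =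
      ∑ m, quadForm (h i) (X m) - t * quadForm (h i) (X j) := by
    intro t i
    simp [Y, quadForm_sub, apply_ite (quadForm (h i)), quadForm_zero, quadForm_smul]
  have hgap : ∀ t i, sinrGap h γ (Y t) i = sinrGap h γ X i +
      t * (quadForm (h i) (X j) -
        (1 / γ i + 1) * (if i = j then quadForm (h i) (X j) else 0)) := by
    intro t i
    rw [sinrGap_eq, sinrGap_eq, hsum]
    simp only [Y, quadForm_sub, apply_ite (quadForm (h i)), quadForm_zero, quadForm_smul]
    split_ifs <;> ring
  have hev : ∀ᶠ t in nhdsWithin (0 : ℝ) (Set.Ioi 0), ∀ i,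
      σ2 i + δ2 i / ρ' i ≤ sinrGap h γ (Y t) i ∧
      e i / (ζ i * (1 - ρ' i)) - σ2 i ≤ ∑ m, quadForm (h i) (Y t m) := by
    refine Filter.eventually_all.2 fun i => ?_
    simp only [hsum, hgap]
    by_cases hi : i ∈ S
    · have hc1 : Filter.Tendsto (fun t : ℝ => sinrGap h γ X i + t * (quadForm (h i) (X j) -
          (1 / γ i + 1) * (if i = j then quadForm (h i) (X j) else 0)))
          (nhdsWithin 0 (Set.Ioi 0)) (nhds (sinrGap h γ X i)) := by
        refine Filter.Tendsto.mono_left ?_ nhdsWithin_le_nhds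
        exact Continuous.tendsto' (by fun_prop) _ _ (by simp)
      have hc2 : Filter.Tendsto (fun t : ℝ => ∑ m, quadForm (h i) (X m) -
          t * quadForm (h i) (X j))
          (nhdsWithin 0 (Set.Ioi 0)) (nhds (∑ m, quadForm (h i) (X m))) := by
        refine Filter.Tendsto.mono_left ?_ nhdsWithin_le_nhds
        exact Continuous.tendsto' (by fun_prop) _ _ (by simp)
      exact (hc1.eventually_const_le (hstrict i hi).1).and
        (hc2.eventually_const_le (hstrict i hi).2)
    · refine Filter.Eventually.of_forall fun t => ?_
      rw [hdec i hi]
      have hij : i ≠ j := fun hij => hi (hij ▸ hj)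
      simpa only [hij, if_false, mul_zero, sub_zero, add_zero] using ⟨hsinr' i, hen' i⟩
  obtain ⟨t, ht, ht0, ht1⟩ := (hev.and (Ioo_mem_nhdsGT (zero_lt_one' ℝ))).exists
  refine ⟨Y t, ρ', ⟨fun i => ?_, hρ', fun i => (ht i).1, fun i => (ht i).2⟩, ?_⟩
  · by_cases hij : i = j
    · subst hij
      have h1 : Y t i = (1 - t) • X i := by simp [Y, sub_smul]
      rw [h1]
      exact (hpsd i).smul (by linarith)
    · simpa [Y, hij] using hpsd i
  · have htr : 0 < (X j).trace.re :=
      trace_re_pos (hpsd j) fun h0 => by simp [h0, quadForm_zero] at hjpos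
    have h2 : ∑ k, (Y t k).trace = ∑ k, (X k).trace - t • (X j).trace := by
      simp [Y, trace_sub, apply_ite Matrix.trace, trace_smul]
    rw [h2, Complex.sub_re, Complex.smul_re, smul_eq_mul]
    linarith [mul_pos ht0 htr]

/-- A feasible point of the relaxation with an inactive SINR constraint is not optimal. -/
lemma SDRFeasible.exists_trace_lt_of_slack (hσ : ∀ k, 0 < σ2 k) (hδ : ∀ k, 0 < δ2 k)
    (hζ : ∀ k, 0 < ζ k) (hγ : ∀ k, 0 < γ k) (he : ∀ k, 0 < e k)
    {X : Fin K → Matrix (Fin Nt) (Fin Nt) ℂ} {ρ : Fin K → ℝ}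
    (hf : SDRFeasible h σ2 δ2 ζ γ e X ρ) {S : Finset (Fin K)} (hS : S.Nonempty)
    (hslack : ∀ i ∈ S, σ2 i + δ2 i / ρ i < sinrGap h γ X i) :
    ∃ X' ρ', SDRFeasible h σ2 δ2 ζ γ e X' ρ' ∧
      (∑ k, (X' k).trace).re < (∑ k, (X k).trace).re := by
  induction hn : Sᶜ.card using Nat.strong_induction_on generalizing S X with
  | _ n ih =>
    by_cases hc : ∃ j ∈ S, ∃ k ∉ S, quadForm (h k) (X j) ≠ 0
    · obtain ⟨j, hj, k, hk, hjk⟩ := hc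
      have hkj : k ≠ j := fun hkj => hk (hkj ▸ hj)
      have hpos : 0 < quadForm (h k) (X j) :=
        lt_of_le_of_ne (quadForm_nonneg _ (hf.1 j)) hjk.symm
      have hlim : Filter.Tendsto
          (fun t : ℝ => sinrGap h γ X j - (1 / γ j + 1) * (t * quadForm (h j) (X j)))
          (nhdsWithin 0 (Set.Ioi 0)) (nhds (sinrGap h γ X j)) := by
        refine Filter.Tendsto.mono_left ?_ nhdsWithin_le_nhds
        exact Continuous.tendsto' (by fun_prop) _ _ (by simp)
      obtain ⟨t, ht, ht0, ht1⟩ := ((hlim.eventually_const_lt (hslack j hj)).and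
        (Ioo_mem_nhdsGT (zero_lt_one' ℝ))).exists
      rw [← quadForm_smul] at ht
      have hf' := hf.transfer hγ hkj ((hf.1 j).smul ht0.le)
        (by
          have h1 : X j - t • X j = (1 - t) • X j := by simp [sub_smul]
          rw [h1]
          exact (hf.1 j).smul (by linarith)) ht.le
      have hcard : (insert k S)ᶜ.card < n := by
        rw [← hn]
        exact Finset.card_lt_card (Finset.compl_ssubset_compl.2 (Finset.ssubset_insert hk))
      rw [← sum_trace_transfer X j k (t • X j)]
      refine ih _ hcard hf' (Finset.insert_nonempty _ _) (fun i hi => ?_) rfl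
      rw [sinrGap_transfer]
      rcases Finset.mem_insert.1 hi with rfl | hi
      · have h1 : σ2 i + δ2 i / ρ i ≤ sinrGap h γ X i := hf.2.2.1 i
        have h2 : 0 < (1 / γ i + 1) * quadForm (h i) (t • X j) := by
          rw [quadForm_smul]
          have := hγ i
          positivity
        simp only [hkj, if_true, if_false, sub_zero]
        linarith
      · have hik : i ≠ k := fun hik => hk (hik ▸ hi)
        by_cases hij : i = j
        · subst hij
          simp only [hik, if_true, if_false]
          linarith
        · simpa [hij, hik] using hslack i hi
    · push Not at hc
      obtain ⟨j, hj⟩ := hS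
      exact hf.exists_trace_lt_of_decoupled hσ hδ hζ hγ he hslack hj (hc j hj)

/-- Every user's covariance in an optimal point of the relaxation has rank one. -/
lemma SDRFeasible.eq_smul_vecMulVec_of_isOptimal (hσ : ∀ k, 0 < σ2 k) (hδ : ∀ k, 0 < δ2 k)
    (hζ : ∀ k, 0 < ζ k) (hγ : ∀ k, 0 < γ k) (he : ∀ k, 0 < e k)
    {X : Fin K → Matrix (Fin Nt) (Fin Nt) ℂ} {ρ : Fin K → ℝ}
    (hf : SDRFeasible h σ2 δ2 ζ γ e X ρ)
    (hopt : ∀ (X' : Fin K → Matrix (Fin Nt) (Fin Nt) ℂ) (ρ' : Fin K → ℝ),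
      SDRFeasible h σ2 δ2 ζ γ e X' ρ' →
      (∑ k, (X k).trace).re ≤ (∑ k, (X' k).trace).re) (k : Fin K) :
    X k = (quadForm (h k) (X k))⁻¹ • vecMulVec (X k *ᵥ h k) (star (X k *ᵥ h k)) := by
  have hq := hf.quadForm_self_pos hσ hδ hγ k
  have hR := posSemidef_sub_vecMulVec (hf.1 k) (h k) hq
  have hP : ((quadForm (h k) (X k))⁻¹ •
      vecMulVec (X k *ᵥ h k) (star (X k *ᵥ h k))).PosSemidef :=
    (posSemidef_vecMulVec_self_star _).smul (inv_pos.2 hq).le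
  set P := (quadForm (h k) (X k))⁻¹ • vecMulVec (X k *ᵥ h k) (star (X k *ᵥ h k)) with hPdef
  have hRk : quadForm (h k) (X k - P) = 0 := by
    rw [quadForm_sub, hPdef, quadForm_smul, quadForm_vecMulVec, ← ofReal_quadForm _ (hf.1 k),
      Complex.norm_real, Real.norm_eq_abs, sq_abs]
    field_simp
    ring
  by_contra hne
  have hR0 : X k - P ≠ 0 := sub_ne_zero.2 hne
  by_cases hc : ∃ j, quadForm (h j) (X k - P) ≠ 0
  · obtain ⟨j, hj⟩ := hc
    have hjk : j ≠ k := fun hjk => hj (hjk ▸ hRk)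
    have hjpos : 0 < quadForm (h j) (X k - P) :=
      lt_of_le_of_ne (quadForm_nonneg _ hR) hj.symm
    have hf' := hf.transfer hγ hjk hR (by simpa using hP)
      (by rw [hRk, mul_zero, sub_zero]; exact hf.2.2.1 k)
    obtain ⟨X', ρ', h1, h2⟩ := hf'.exists_trace_lt_of_slack hσ hδ hζ hγ he
      (Finset.singleton_nonempty j) (fun i hi => by
        rw [Finset.mem_singleton.1 hi, sinrGap_transfer]
        have h1 : σ2 j + δ2 j / ρ j ≤ sinrGap h γ X j := hf.2.2.1 j
        have h2 : 0 < (1 / γ j + 1) * quadForm (h j) (X k - P) := by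
          have := hγ j
          positivity
        simp only [hjk, if_true, if_false, sub_zero]
        linarith)
    rw [sum_trace_transfer] at h2
    exact absurd (hopt X' ρ' h1) h2.not_ge
  · push Not at hc
    have hquad : ∀ i m, quadForm (h i) (Function.update X k P m) = quadForm (h i) (X m) := by
      intro i m
      by_cases hm : m = k
      · subst hm
        have := hc i
        rw [quadForm_sub] at this
        rw [Function.update_self]
        linarith
      · rw [Function.update_of_ne hm]
    have hf' : SDRFeasible h σ2 δ2 ζ γ e (Function.update X k P) ρ := by
      refine ⟨fun i => ?_, hf.2.1, fun i => ?_, fun i => ?_⟩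
      · by_cases hi : i = k
        · subst hi
          simpa using hP
        · simpa [hi] using hf.1 i
      · simpa only [hquad] using hf.2.2.1 i
      · simpa only [hquad] using hf.2.2.2 i
    have h1 := hopt _ _ hf'
    have h2 := trace_re_pos hR hR0
    have h3 : ∑ i, (Function.update X k P i).trace
        = ∑ i, (X i).trace - (X k - P).trace := by
      rw [← Finset.add_sum_erase _ _ (mem_univ k), ← Finset.add_sum_erase univ
        (fun i => (X i).trace) (mem_univ k), Function.update_self, trace_sub,
        Finset.sum_congr rfl fun i hi => by
          rw [Function.update_of_ne (Finset.ne_of_mem_erase hi)]]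
      ring
    rw [h3, Complex.sub_re] at h1
    linarith

/-- On rank-one covariances the relaxation and the original problem have the same constraints. -/
lemma sdrFeasible_vecMulVec_iff (hσ : ∀ k, 0 < σ2 k) (hδ : ∀ k, 0 < δ2 k)
    (hζ : ∀ k, 0 < ζ k) (hγ : ∀ k, 0 < γ k) (v : Fin K → (Fin Nt → ℂ)) (ρ : Fin K → ℝ) :
    SDRFeasible h σ2 δ2 ζ γ e (fun k => vecMulVec (v k) (star (v k))) ρ ↔
      JBPSFeasible h σ2 δ2 ζ γ e v ρ := by
  have hpsd : ∀ k, (vecMulVec (v k) (star (v k))).PosSemidef :=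
    fun k => posSemidef_vecMulVec_self_star _
  simp only [SDRFeasible, JBPSFeasible, quadForm_vecMulVec, hpsd, implies_true, true_and]
  refine and_congr_right fun hρ => and_congr (forall_congr' fun k => ?_)
    (forall_congr' fun k => ?_)
  · have h1 := (hρ k).1
    have h2 := hγ k
    have h3 := hσ k
    have h4 := hδ k
    have hI : 0 ≤ ∑ j ∈ univ.erase k, ‖star (h k) ⬝ᵥ v j‖ ^ 2 :=
      Finset.sum_nonneg fun j _ => sq_nonneg _
    generalize ∑ j ∈ univ.erase k, ‖star (h k) ⬝ᵥ v j‖ ^ 2 = I at hI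
    generalize ‖star (h k) ⬝ᵥ v k‖ ^ 2 = a
    have hden : 0 < ρ k * I + ρ k * σ2 k + δ2 k := by positivity
    have hkey : 1 / γ k * a - I - (σ2 k + δ2 k / ρ k) =
        (ρ k * a - γ k * (ρ k * I + ρ k * σ2 k + δ2 k)) / (γ k * ρ k) := by
      field_simp
      ring
    rw [le_div_iff₀ hden, ← sub_nonneg, hkey, le_div_iff₀ (mul_pos h2 h1), zero_mul, sub_nonneg]
  · have h1 : 0 < ζ k * (1 - ρ k) := mul_pos (hζ k) (by linarith [(hρ k).2])
    rw [sub_le_iff_le_add, div_le_iff₀ h1, mul_comm]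

end Relaxation

theorem sdr_optimal_yields_jbps_optimal (K Nt : ℕ) (hK : 1 ≤ K) (hNt : 1 ≤ Nt)
    (h : Fin K → (Fin Nt → ℂ)) (σ2 δ2 ζ γ e : Fin K → ℝ)
    (hσ : ∀ k, 0 < σ2 k) (hδ : ∀ k, 0 < δ2 k)
    (hζ : ∀ k, 0 < ζ k ∧ ζ k ≤ 1) (hγ : ∀ k, 0 < γ k) (he : ∀ k, 0 < e k)
    (X : Fin K → Matrix (Fin Nt) (Fin Nt) ℂ) (ρ : Fin K → ℝ)
    (hfeas : SDRFeasible h σ2 δ2 ζ γ e X ρ)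
    (hopt : ∀ (X' : Fin K → Matrix (Fin Nt) (Fin Nt) ℂ) (ρ' : Fin K → ℝ),
      SDRFeasible h σ2 δ2 ζ γ e X' ρ' →
      (∑ k, (X k).trace).re ≤ (∑ k, (X' k).trace).re) :
    ∃ v : Fin K → (Fin Nt → ℂ),
      (∀ k, X k = vecMulVec (v k) (star (v k))) ∧
      JBPSFeasible h σ2 δ2 ζ γ e v ρ ∧
      (∑ k, ∑ i, ‖v k i‖ ^ 2) = (∑ k, (X k).trace).re ∧
      (∀ (v' : Fin K → (Fin Nt → ℂ)) (ρ' : Fin K → ℝ),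
        JBPSFeasible h σ2 δ2 ζ γ e v' ρ' →
        (∑ k, ∑ i, ‖v k i‖ ^ 2) ≤ ∑ k, ∑ i, ‖v' k i‖ ^ 2) := by
  have hζ' : ∀ k, 0 < ζ k := fun k => (hζ k).1
  let q : Fin K → ℝ := fun k => quadForm (h k) (X k)
  let v : Fin K → (Fin Nt → ℂ) := fun k => (√(q k))⁻¹ • (X k *ᵥ h k)
  have hX : ∀ k, X k = vecMulVec (v k) (star (v k)) := by
    intro k
    have hq : 0 < q k := hfeas.quadForm_self_pos hσ hδ hγ k
    have hsq : (√(q k))⁻¹ * (√(q k))⁻¹ = (q k)⁻¹ := by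
      rw [← mul_inv, Real.mul_self_sqrt hq.le]
    conv_lhs => rw [hfeas.eq_smul_vecMulVec_of_isOptimal hσ hδ hζ' hγ he hopt k]
    simp only [v, star_smul, star_trivial, smul_vecMulVec, vecMulVec_smul, smul_smul, hsq, q]
  have hcost : (∑ k, ∑ i, ‖v k i‖ ^ 2) = (∑ k, (X k).trace).re := by
    rw [Complex.re_sum]
    exact Finset.sum_congr rfl fun k _ => by rw [hX k, trace_vecMulVec_star_re]
  refine ⟨v, hX, ?_, hcost, fun v' ρ' hv' => ?_⟩
  · rw [← sdrFeasible_vecMulVec_iff hσ hδ hζ' hγ, ← funext hX]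
    exact hfeas
  · have h1 := hopt _ _ ((sdrFeasible_vecMulVec_iff hσ hδ hζ' hγ v' ρ').2 hv')
    rw [hcost]
    refine h1.trans_eq ?_
    rw [Complex.re_sum]
    exact Finset.sum_congr rfl fun k _ => trace_vecMulVec_star_re _
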